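/- arXiv:2311.07808 — 6 statements merged into one kernel-verified Lean document; each statement's English description precedes it below -/
import Mathlib

section
/- Abstracted guarantee of the primal-dual algorithm: let f : Finset V → ℝ satisfy f(∅) = 0, let k ≥ 1 be an integer, let D ∈ ℝ, let p_1, …, p_k ∈ V, and define the chain A_0 = ∅ and A_{i+1} = A_i ∪ {p_{i+1}} for 0 ≤ i < k. Suppose that for every 0 ≤ i < k the stall condition k·(f(A_{i+1}) − f(A_i)) + f(A_i) ≥ D holds. Then f(A_k) ≥ (1 − (1 − 1/k)^k)·D. -/
/-- If the gap `D - a i` contracts by a factor `c ≥ 0` in each of the first `n` steps, then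
after `n` steps it is at most `c ^ n` times the initial gap. -/
theorem sub_le_pow_mul_sub_of_contracting {a : ℕ → ℝ} {c D : ℝ} (hc : 0 ≤ c) {n : ℕ}
    (h : ∀ i < n, D - a (i + 1) ≤ c * (D - a i)) : D - a n ≤ c ^ n * (D - a 0) := by
  induction n with
  | zero => simp
  | succ n ih =>
    calc D - a (n + 1) ≤ c * (D - a n) := h n n.lt_succ_self
      _ ≤ c * (c ^ n * (D - a 0)) :=
        mul_le_mul_of_nonneg_left (ih fun i hi => h i (hi.trans n.lt_succ_self)) hc
      _ = c ^ (n + 1) * (D - a 0) := by ring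

theorem stmt_4 {V : Type*} [DecidableEq V]
    (f : Finset V → ℝ) (hf0 : f ∅ = 0)
    (k : ℕ) (hk : 1 ≤ k) (D : ℝ)
    (p : ℕ → V) (A : ℕ → Finset V)
    (hA0 : A 0 = ∅)
    (hAsucc : ∀ i < k, A (i + 1) = insert (p (i + 1)) (A i))
    (hstall : ∀ i < k, (k : ℝ) * (f (A (i + 1)) - f (A i)) + f (A i) ≥ D) :
    f (A k) ≥ (1 - (1 - 1 / (k : ℝ)) ^ k) * D := by
  have hk1 : (1 : ℝ) ≤ k := by exact_mod_cast hk
  have hk0 : (0 : ℝ) < k := by linarith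
  have hc : 0 ≤ 1 - 1 / (k : ℝ) := sub_nonneg.2 ((div_le_one hk0).2 hk1)
  have hgap := sub_le_pow_mul_sub_of_contracting (a := fun i => f (A i)) (D := D) hc (n := k)
    fun i hi => by
      have hstep : (D - f (A i)) / k ≤ f (A (i + 1)) - f (A i) :=
        (div_le_iff₀' hk0).2 (by linarith [hstall i hi])
      have hexpand : (1 - 1 / (k : ℝ)) * (D - f (A i)) = D - f (A i) - (D - f (A i)) / k := by
        ring
      simp only [hexpand]
      linarith
  simp only [hA0, hf0, sub_zero] at hgap
  linarith
end

section
/- Let V be a finite set, let k ≥ 1 be an integer, and let R ⊆ V with |R| = k. Define r : Finset V → ℝ by r(S) = |S| if |S| ≤ k − 1; r(S) = k − 1 if S = R; and r(S) = k otherwise (i.e., if |S| ≥ k and S ≠ R). Then r is monotone and submodular. -/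
theorem stmt_8 {V : Type*} [Fintype V] [DecidableEq V]
    (k : ℕ) (hk : 1 ≤ k)
    (R : Finset V) (hR : R.card = k)
    (r : Finset V → ℝ)
    (hr : ∀ S : Finset V, r S =
      if S.card ≤ k - 1 then (S.card : ℝ)
      else if S = R then (k : ℝ) - 1
      else (k : ℝ)) :
    (∀ A B : Finset V, A ⊆ B → r A ≤ r B) ∧
      (∀ A B : Finset V, r A + r B ≥ r (A ∪ B) + r (A ∩ B)) := by
  obtain ⟨m, rfl⟩ : ∃ m, k = m + 1 := ⟨k - 1, by omega⟩
  have small : ∀ S : Finset V, S.card ≤ m → r S = S.card := fun S h => by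
    rw [hr, if_pos (by omega)]
  have rank_R : r R = m := by
    rw [hr, if_neg (by omega), if_pos rfl]
    push_cast
    ring
  have large : ∀ S : Finset V, m < S.card → S ≠ R → r S = m + 1 := fun S h hS => by
    rw [hr, if_neg (by omega), if_neg hS]
    push_cast
    ring
  have le_top : ∀ S : Finset V, r S ≤ m + 1 := fun S => by
    rcases le_or_gt S.card m with h | h
    · have : (S.card : ℝ) ≤ m := by exact_mod_cast h
      linarith [small S h]
    · by_cases hS : S = R
      · subst hS
        linarith
      · exact (large S h hS).le
  have ge_of_large : ∀ S : Finset V, m < S.card → (m : ℝ) ≤ r S := fun S h => by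
    by_cases hS : S = R
    · rw [hS, rank_R]
    · linarith [large S h hS]
  have le_card : ∀ S : Finset V, r S ≤ S.card := fun S => by
    rcases le_or_gt S.card m with h | h
    · exact (small S h).le
    · have : (m : ℝ) + 1 ≤ S.card := by exact_mod_cast h
      linarith [le_top S]
  constructor
  · intro A B hAB
    have hc := Finset.card_le_card hAB
    rcases le_or_gt B.card m with hB | hB
    · rw [small B hB, small A (hc.trans hB)]
      exact_mod_cast hc
    · by_cases hBR : B = R
      · rcases le_or_gt A.card m with hA | hA
        · have : (A.card : ℝ) ≤ m := by exact_mod_cast hA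
          linarith [small A hA, ge_of_large B hB]
        · have : A = B := Finset.eq_of_subset_of_card_le hAB (by rw [hBR]; omega)
          rw [this]
      · rw [large B hB hBR]
        exact le_top A
  · intro A B
    by_cases hAB : A ⊆ B
    · rw [Finset.union_eq_right.2 hAB, Finset.inter_eq_left.2 hAB]
      linarith
    by_cases hBA : B ⊆ A
    · rw [Finset.union_eq_left.2 hBA, Finset.inter_eq_right.2 hBA]
    have hIA : (A ∩ B).card < A.card := Finset.card_lt_card
      ⟨Finset.inter_subset_left, fun h => hAB (h.trans Finset.inter_subset_right)⟩
    have hIB : (A ∩ B).card < B.card := Finset.card_lt_card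
      ⟨Finset.inter_subset_right, fun h => hBA (h.trans Finset.inter_subset_left)⟩
    have hIA' : ((A ∩ B).card : ℝ) + 1 ≤ A.card := by exact_mod_cast hIA
    have hIB' : ((A ∩ B).card : ℝ) + 1 ≤ B.card := by exact_mod_cast hIB
    have hU := le_top (A ∪ B)
    have hI := le_card (A ∩ B)
    rcases le_or_gt A.card m with hA | hA <;> rcases le_or_gt B.card m with hB | hB
    · have : ((A ∪ B).card : ℝ) + (A ∩ B).card = A.card + B.card := by
        exact_mod_cast Finset.card_union_add_card_inter A B
      linarith [small A hA, small B hB, le_card (A ∪ B)]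
    · linarith [small A hA, ge_of_large B hB]
    · linarith [small B hB, ge_of_large A hA]
    · by_cases hAR : A = R
      · have hBR : B ≠ R := fun h => hAB (by rw [hAR, h])
        have : (A.card : ℝ) = m + 1 := by rw [hAR, hR]; push_cast; ring
        linarith [large B hB hBR, ge_of_large A hA]
      · by_cases hBR : B = R
        · have : (B.card : ℝ) = m + 1 := by rw [hBR, hR]; push_cast; ring
          linarith [large A hA hAR, ge_of_large B hB]
        · linarith [large A hA hAR, large B hB hBR, le_top (A ∩ B)]
end

section
/- Let W be a finite set, let k ≥ 1 be an integer, let R ⊆ W with |R| = k, and let r : Finset W → ℝ be defined by r(S) = |S| if |S| ≤ k − 1; r(S) = k − 1 if S = R; and r(S) = k otherwise. Let the ground set be V = {e₁, e₂} ⊔ W (the disjoint union of two new elements with W), and for S ⊆ V with T := S ∩ W define f(S) = r(T) + min(|T|, k) if S ∩ {e₁, e₂} = ∅, and f(S) = r(T) + k otherwise. Then f is monotone and submodular. -/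
/-- The rank function of the paving matroid of rank `k` whose only dependent `k`-set is `R`,
written over the integers. -/
def pavingRank {W : Type*} [DecidableEq W] (k : ℕ) (R S : Finset W) : ℤ :=
  min (S.card : ℤ) k - if S = R then 1 else 0

theorem pavingRank_mono {W : Type*} [DecidableEq W] {k : ℕ} {R : Finset W} (hR : R.card = k)
    {A B : Finset W} (h : A ⊆ B) : pavingRank k R A ≤ pavingRank k R B := by
  rcases eq_or_ne A B with rfl | hne
  · rfl
  have hlt : A.card < B.card := Finset.card_lt_card (h.ssubset_of_ne hne)
  unfold pavingRank
  by_cases hB : B = R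
  · subst hB
    split_ifs <;> omega
  · split_ifs <;> omega

theorem pavingRank_submodular {W : Type*} [DecidableEq W] {k : ℕ} {R : Finset W}
    (hR : R.card = k) (A B : Finset W) :
    pavingRank k R (A ∪ B) + pavingRank k R (A ∩ B) ≤ pavingRank k R A + pavingRank k R B := by
  by_cases hAB : A ⊆ B
  · rw [Finset.union_eq_right.2 hAB, Finset.inter_eq_left.2 hAB, add_comm]
  by_cases hBA : B ⊆ A
  · rw [Finset.union_eq_left.2 hBA, Finset.inter_eq_right.2 hBA]
  have hA : (A ∩ B).card < A.card := Finset.card_lt_card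
    (Finset.inter_subset_left.ssubset_of_ne fun h => hAB (Finset.inter_eq_left.1 h))
  have hB : (A ∩ B).card < B.card := Finset.card_lt_card
    (Finset.inter_subset_right.ssubset_of_ne fun h => hBA (Finset.inter_eq_right.1 h))
  have hcard := Finset.card_union_add_card_inter A B
  have hAR : A = R → A.card = k := fun h => h ▸ hR
  have hBR : B = R → B.card = k := fun h => h ▸ hR
  have hne : A = R → B ≠ R := fun h h' => hAB (h.trans h'.symm).subset
  unfold pavingRank
  split_ifs <;> first | omega | simp_all <;> omega

theorem cast_pavingRank {W : Type*} [DecidableEq W] {k : ℕ} (hk : 1 ≤ k) {R : Finset W}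
    (hR : R.card = k) (S : Finset W) :
    (pavingRank k R S : ℝ) =
      if S.card ≤ k - 1 then (S.card : ℝ) else if S = R then (k : ℝ) - 1 else (k : ℝ) := by
  unfold pavingRank
  by_cases h : S.card ≤ k - 1
  · have hS : S ≠ R := by rintro rfl; omega
    rw [if_pos h, if_neg hS, min_eq_left (by omega)]
    simp
  · rw [if_neg h, min_eq_right (by omega)]
    split_ifs <;> simp


theorem stmt_9 {W : Type*} [Fintype W] [DecidableEq W]
    (k : ℕ) (hk : 1 ≤ k)
    (R : Finset W) (hR : R.card = k)
    (r : Finset W → ℝ)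
    (hr : ∀ S : Finset W, r S =
      if S.card ≤ k - 1 then (S.card : ℝ)
      else if S = R then (k : ℝ) - 1
      else (k : ℝ))
    (f : Finset (Fin 2 ⊕ W) → ℝ)
    (hf : ∀ S : Finset (Fin 2 ⊕ W),
      f S =
        if Sum.inl 0 ∉ S ∧ Sum.inl 1 ∉ S then
          r (Finset.univ.filter fun w : W => Sum.inr w ∈ S)
            + (min (Finset.univ.filter fun w : W => Sum.inr w ∈ S).card k : ℝ)
        else
          r (Finset.univ.filter fun w : W => Sum.inr w ∈ S) + (k : ℝ)) :
    (∀ A B : Finset (Fin 2 ⊕ W), A ⊆ B → f A ≤ f B) ∧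
      (∀ A B : Finset (Fin 2 ⊕ W), f A + f B ≥ f (A ∪ B) + f (A ∩ B)) := by
  classical
  set T : Finset (Fin 2 ⊕ W) → Finset W := fun S => Finset.univ.filter fun w => Sum.inr w ∈ S
    with hT
  set g : Finset (Fin 2 ⊕ W) → ℤ := fun S =>
    if Sum.inl 0 ∉ S ∧ Sum.inl 1 ∉ S then min ((T S).card : ℤ) k else k with hg
  have hfg : ∀ S, f S = ((pavingRank k R (T S) + g S : ℤ) : ℝ) := by
    intro S
    rw [hf, Int.cast_add, cast_pavingRank hk hR, ← hr]
    simp only [hg]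
    split_ifs <;> simp [hT]
  have hTunion : ∀ A B, T (A ∪ B) = T A ∪ T B := by
    intro A B; ext; simp [hT]
  have hTinter : ∀ A B, T (A ∩ B) = T A ∩ T B := by
    intro A B; ext; simp [hT]
  refine ⟨fun A B h => ?_, fun A B => ?_⟩
  · have hTAB : T A ⊆ T B := by
      intro w hw
      simp only [hT, Finset.mem_filter, Finset.mem_univ, true_and] at hw ⊢
      exact h hw
    have hrank := pavingRank_mono hR hTAB
    have hcard := Finset.card_le_card hTAB
    have hmono : g A ≤ g B := by
      have h0 := @h (Sum.inl 0)
      have h1 := @h (Sum.inl 1)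
      simp only [hg]
      split_ifs <;> first | omega | tauto
    rw [hfg, hfg]
    exact_mod_cast add_le_add hrank hmono
  · have hrank := pavingRank_submodular hR (T A) (T B)
    have hsub : g (A ∪ B) + g (A ∩ B) ≤ g A + g B := by
      have hcard := Finset.card_union_add_card_inter (T A) (T B)
      have hA := Finset.card_le_card (Finset.inter_subset_left (s₁ := T A) (s₂ := T B))
      have hB := Finset.card_le_card (Finset.inter_subset_right (s₁ := T A) (s₂ := T B))
      simp only [hg, hTunion, hTinter, Finset.mem_union, Finset.mem_inter]
      split_ifs <;> first | omega | tauto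
    rw [hfg, hfg, hfg, hfg, hTunion, hTinter, ge_iff_le]
    exact_mod_cast (by linarith : pavingRank k R (T A ∪ T B) + g (A ∪ B) +
      (pavingRank k R (T A ∩ T B) + g (A ∩ B)) ≤
      pavingRank k R (T A) + g A + (pavingRank k R (T B) + g B))
end

section
/- Let W be a finite set, let k ≥ 1 be an integer, let R ⊆ W with |R| = k, let r and the lifted function f on V = {e₁, e₂} ⊔ W be as defined (f(S) = r(S ∩ W) + min(|S ∩ W|, k) if S ∩ {e₁, e₂} = ∅, and f(S) = r(S ∩ W) + k otherwise). Define h(S) := f(S ∪ {e₁}) + f(S ∪ {e₂}) − f(S). Then for every S ⊆ W one has h(S) = r(S) + 2k − min(|S|, k), hence h(S) ≥ 2k − 1, with equality if and only if S = R. In other words, among subsets of W, the hidden set R is the unique minimizer of h. -/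
theorem stmt_10 {W : Type*} [Fintype W] [DecidableEq W]
    (k : ℕ) (hk : 1 ≤ k)
    (R : Finset W) (hR : R.card = k)
    (r : Finset W → ℝ)
    (hr : ∀ S : Finset W, r S =
      if S.card ≤ k - 1 then (S.card : ℝ)
      else if S = R then (k : ℝ) - 1
      else (k : ℝ))
    (f : Finset (Fin 2 ⊕ W) → ℝ)
    (hf : ∀ S : Finset (Fin 2 ⊕ W),
      f S =
        if Sum.inl 0 ∉ S ∧ Sum.inl 1 ∉ S then
          r (Finset.univ.filter fun w : W => Sum.inr w ∈ S)
            + (min (Finset.univ.filter fun w : W => Sum.inr w ∈ S).card k : ℝ)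
        else
          r (Finset.univ.filter fun w : W => Sum.inr w ∈ S) + (k : ℝ))
    (h : Finset W → ℝ)
    (hh : ∀ S : Finset W,
      h S = f (insert (Sum.inl 0) (S.image Sum.inr))
              + f (insert (Sum.inl 1) (S.image Sum.inr))
              - f (S.image Sum.inr)) :
    ∀ S : Finset W,
      h S = r S + 2 * (k : ℝ) - (min S.card k : ℝ) ∧
      h S ≥ 2 * (k : ℝ) - 1 ∧
      (h S = 2 * (k : ℝ) - 1 ↔ S = R) := by
  intro S
  have inr_preimage : (Finset.univ.filter fun w : W =>
      (Sum.inr w : Fin 2 ⊕ W) ∈ S.image Sum.inr) = S := by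
    ext w; simp
  have inr_preimage_insert (i : Fin 2) : (Finset.univ.filter fun w : W =>
      (Sum.inr w : Fin 2 ⊕ W) ∈ insert (Sum.inl i) (S.image Sum.inr)) = S := by
    ext w; simp
  have f_image : f (S.image Sum.inr) = r S + (min S.card k : ℝ) := by
    rw [hf, if_pos (by simp), inr_preimage]
  have f_insert (i : Fin 2) : f (insert (Sum.inl i) (S.image Sum.inr)) = r S + k := by
    rw [hf, if_neg (by fin_cases i <;> simp), inr_preimage_insert]
  have h_eq : h S = r S + 2 * (k : ℝ) - (min S.card k : ℝ) := by
    rw [hh, f_insert, f_insert, f_image]; ring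
  refine ⟨h_eq, ?_⟩
  rw [h_eq, hr]
  by_cases hS : S.card ≤ k - 1
  · have hle : (S.card : ℝ) ≤ k := by exact_mod_cast hS.trans (Nat.sub_le k 1)
    have hne : S ≠ R := by rintro rfl; omega
    rw [if_pos hS, min_eq_left hle]
    exact ⟨by linarith, fun h' => by linarith, fun h' => absurd h' hne⟩
  · have hle : (k : ℝ) ≤ S.card := by exact_mod_cast (by omega : k ≤ S.card)
    rw [if_neg hS, min_eq_right hle]
    by_cases hSR : S = R
    · rw [if_pos hSR]
      exact ⟨by linarith, fun _ => hSR, fun _ => by ring⟩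
    · rw [if_neg hSR]
      exact ⟨by linarith, fun h' => by linarith, fun h' => absurd h' hSR⟩
end

section
/- Single round of randomized rounding: let f : Finset V → ℝ be monotone and submodular, let k ≥ 1 be an integer, let x : V → ℝ satisfy x_j ≥ 0 for all j and ∑_{j ∈ V} x_j = k, and let λ ∈ ℝ and R ⊆ V satisfy λ ≤ f(R) + ∑_{j ∈ V} f_R(j)·x_j. Then ∑_{j ∈ V} (x_j / k)·f(R ∪ {j}) ≥ (1 − 1/k)·f(R) + λ/k. -/
theorem stmt_11 {V : Type*} [Fintype V] [DecidableEq V]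
    (f : Finset V → ℝ)
    (hmono : ∀ A B : Finset V, A ⊆ B → f A ≤ f B)
    (hsub : ∀ A B : Finset V, f A + f B ≥ f (A ∪ B) + f (A ∩ B))
    (k : ℕ) (hk : 1 ≤ k)
    (x : V → ℝ) (hx : ∀ j, 0 ≤ x j) (hxsum : ∑ j, x j = (k : ℝ))
    (lam : ℝ) (R : Finset V)
    (hfeas : lam ≤ f R + ∑ j, (f (insert j R) - f R) * x j) :
    ∑ j, (x j / k) * f (insert j R) ≥ (1 - 1 / (k : ℝ)) * f R + lam / k := by
  have hk0 : (0 : ℝ) < k := by exact_mod_cast hk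
  have hmarg : ∑ j, (f (insert j R) - f R) * x j = ∑ j, x j * f (insert j R) - k * f R := by
    rw [← hxsum, Finset.sum_mul, ← Finset.sum_sub_distrib]
    exact Finset.sum_congr rfl fun j _ => by ring
  have hexp : ∑ j, (x j / k) * f (insert j R) = (∑ j, x j * f (insert j R)) / k := by
    rw [Finset.sum_div]
    exact Finset.sum_congr rfl fun j _ => by ring
  have hrhs : (1 - 1 / (k : ℝ)) * f R + lam / k = (k * f R - f R + lam) / k := by
    field_simp
  rw [hexp, hrhs, ge_iff_le, div_le_div_iff_of_pos_right hk0]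
  linarith
end

section
/- Randomized rounding of Wolsey's LP: let f : Finset V → ℝ be monotone and submodular with f(∅) = 0, let k ≥ 1 be an integer, and let x : V → ℝ and λ ∈ ℝ be a feasible primal solution: x_j ≥ 0 for all j, ∑_{j ∈ V} x_j = k, and λ ≤ f(S) + ∑_{j ∈ V} f_S(j)·x_j for every S ⊆ V. Then ∑_{v ∈ V^{k}} (∏_{i=1}^{k} x_{v_i}/k) · f({v_1, …, v_k}) ≥ (1 − (1 − 1/k)^k)·λ; i.e., if k elements are drawn independently, each with distribution (x_j/k)_{j ∈ V}, and R is the set of drawn elements, then E[f(R)] ≥ (1 − (1 − 1/k)^k)·λ. -/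
/-- If drawing one element with distribution `p` closes, in expectation, a `1 - c` fraction of the
gap between `f S` and `lam` for every `S`, then `n` independent draws leave at most a `c ^ n`
fraction of the initial gap. -/
theorem sum_prod_mul_union_image_ge {V : Type*} [Fintype V] [DecidableEq V]
    (f : Finset V → ℝ) (p : V → ℝ) (hp : ∀ j, 0 ≤ p j) (hpsum : ∑ j, p j = 1)
    (c lam : ℝ) (hc : 0 ≤ c)
    (hstep : ∀ S : Finset V, lam - c * (lam - f S) ≤ ∑ j, p j * f (insert j S))
    (n : ℕ) (T : Finset V) :
    lam - c ^ n * (lam - f T) ≤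
      ∑ v : Fin n → V, (∏ i, p (v i)) * f (T ∪ Finset.univ.image v) := by
  induction n generalizing T with
  | zero => simp
  | succ n ih =>
    have hsplit : ∑ v : Fin (n + 1) → V, (∏ i, p (v i)) * f (T ∪ Finset.univ.image v) =
        ∑ a, p a * ∑ v : Fin n → V,
          (∏ i, p (v i)) * f (insert a T ∪ Finset.univ.image v) := by
      rw [← (Fin.consEquiv fun _ => V).sum_comp, Fintype.sum_prod_type]
      refine Finset.sum_congr rfl fun a _ => ?_
      rw [Finset.mul_sum]
      refine Finset.sum_congr rfl fun v _ => ?_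
      have himage : T ∪ Finset.univ.image (Fin.consEquiv (fun _ => V) (a, v)) =
          insert a T ∪ Finset.univ.image v := by
        ext b
        simp [Fin.exists_fin_succ, eq_comm, or_left_comm]
      rw [himage]
      simp only [Fin.consEquiv_apply, Fin.prod_univ_succ, Fin.cons_zero, Fin.cons_succ, mul_assoc]
    calc lam - c ^ (n + 1) * (lam - f T)
        = lam - c ^ n * (lam - (lam - c * (lam - f T))) := by ring
      _ ≤ lam - c ^ n * (lam - ∑ j, p j * f (insert j T)) := by
        gcongr
        exact hstep T
      _ = ∑ a, p a * (lam - c ^ n * (lam - f (insert a T))) := by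
        have hterm : ∀ a, p a * (lam - c ^ n * (lam - f (insert a T))) =
            p a * (lam - c ^ n * lam) + c ^ n * (p a * f (insert a T)) := fun a => by ring
        simp only [hterm, Finset.sum_add_distrib, ← Finset.sum_mul, ← Finset.mul_sum, hpsum]
        ring
      _ ≤ _ := by
        rw [hsplit]
        exact Finset.sum_le_sum fun a _ => mul_le_mul_of_nonneg_left (ih _) (hp a)

theorem stmt_12 {V : Type*} [Fintype V] [DecidableEq V]
    (f : Finset V → ℝ)
    (hmono : ∀ A B : Finset V, A ⊆ B → f A ≤ f B)
    (hsub : ∀ A B : Finset V, f A + f B ≥ f (A ∪ B) + f (A ∩ B))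
    (hf0 : f ∅ = 0)
    (k : ℕ) (hk : 1 ≤ k)
    (x : V → ℝ) (hx : ∀ j, 0 ≤ x j) (hxsum : ∑ j, x j = (k : ℝ))
    (lam : ℝ)
    (hfeas : ∀ S : Finset V, lam ≤ f S + ∑ j, (f (insert j S) - f S) * x j) :
    ∑ v : Fin k → V, (∏ i, x (v i) / k) * f (Finset.univ.image v)
      ≥ (1 - (1 - 1 / (k : ℝ)) ^ k) * lam := by
  have hk1 : (1 : ℝ) ≤ k := by exact_mod_cast hk
  have hk0 : (0 : ℝ) < k := by linarith
  have hpsum : ∑ j, x j / (k : ℝ) = 1 := by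
    rw [← Finset.sum_div, hxsum, div_self hk0.ne']
  have hc : (0 : ℝ) ≤ 1 - 1 / k := sub_nonneg.2 ((div_le_one hk0).2 hk1)
  have hstep : ∀ S : Finset V,
      lam - (1 - 1 / (k : ℝ)) * (lam - f S) ≤ ∑ j, x j / k * f (insert j S) := by
    intro S
    have hsum : ∑ j, x j / k * f (insert j S) =
        f S + (∑ j, (f (insert j S) - f S) * x j) / k := by
      have hterm : ∀ j, x j / k * f (insert j S) =
          x j / k * f S + (f (insert j S) - f S) * x j / k := fun j => by ring
      simp only [hterm, Finset.sum_add_distrib, ← Finset.sum_mul, hpsum, one_mul,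
        Finset.sum_div]
    rw [hsum]
    calc lam - (1 - 1 / (k : ℝ)) * (lam - f S) = f S + (lam - f S) / k := by ring
      _ ≤ _ := by
        gcongr
        linarith [hfeas S]
  have h := sum_prod_mul_union_image_ge f (fun j => x j / k)
    (fun j => div_nonneg (hx j) hk0.le) hpsum _ lam hc hstep k ∅
  simp only [Finset.empty_union, hf0, sub_zero] at h
  linarith
end
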